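/- arXiv:2309.17381 — 2 statements merged into one kernel-verified Lean document; each statement's English description precedes it below -/
import Mathlib

section
/- Let H_tc = {0} ∪ {classes of 2-element subsets of Λ} ⊆ E_3, and for a partition of Λ into two 4-element sets Q ⊔ Q′ let H_Q = {0} ∪ {classes of S ∪ T : S ⊆ Q, T ⊆ Q′, |S| − |T| = ±2} ⊆ E_3. Call a subset of E_3 hyperelliptic if it is an S_8-translate of H_tc or of H_{{A,B,C,D}}. Then: (i) for every σ ∈ Sp(6,2) and every hyperelliptic subset X ⊆ E_3, the image σ(X) is again a hyperelliptic subset; and (ii) up to the action of S_8 there are exactly two hyperelliptic subsets of E_3, i.e., the S_8-orbits of H_tc and of H_{{A,B,C,D}} are distinct and every hyperelliptic subset lies in one of them. -/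
open Finset

noncomputable section

/-- The ambient 8-dimensional vector space over `𝔽₂`, coordinates indexed by the 8 labels. -/
abbrev W8 : Type := Fin 8 → ZMod 2

/-- The sum-of-coordinates linear functional on `W8`. -/
def sumForm : W8 →ₗ[ZMod 2] ZMod 2 where
  toFun f := ∑ i, f i
  map_add' f g := by simp [Finset.sum_add_distrib]
  map_smul' c f := by simp [Finset.mul_sum]

/-- The even-weight subspace (corresponding to even-cardinality subsets). -/
def V8 : Submodule (ZMod 2) W8 := LinearMap.ker sumForm

lemma mem_V8 {f : W8} : f ∈ V8 ↔ (∑ i, f i) = 0 := LinearMap.mem_ker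

/-- The all-ones vector (the indicator of the full label set `Λ`). -/
def oneW : W8 := fun _ => 1

lemma oneW_mem : oneW ∈ V8 := mem_V8.mpr (by decide)

def oneV : V8 := ⟨oneW, oneW_mem⟩

/-- The line spanned by the all-ones vector. -/
def U8 : Submodule (ZMod 2) V8 := Submodule.span (ZMod 2) {oneV}

/-- `E₃`: even-cardinality subsets of an 8-element set modulo complement, as an
`𝔽₂`-vector space. -/
abbrev E3 : Type := V8 ⧸ U8

/-- The indicator vector of a subset of the labels. -/
def indV (s : Finset (Fin 8)) : W8 := fun i => if i ∈ s then 1 else 0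

lemma indV_mem (s : Finset (Fin 8)) (hs : Even s.card) : indV s ∈ V8 := by
  apply mem_V8.mpr
  have h1 : (∑ i, indV s i) = (s.card : ZMod 2) := by
    simp only [indV]
    rw [Finset.sum_ite_mem, Finset.univ_inter, Finset.sum_const, nsmul_eq_mul, mul_one]
  rw [h1]
  obtain ⟨k, hk⟩ := hs
  rw [hk]
  push_cast
  rw [← two_mul, show (2 : ZMod 2) = 0 by decide, zero_mul]

/-- The class in `E₃` of an even-cardinality subset of the 8-element set. -/
def toE3 (s : Finset (Fin 8)) (hs : Even s.card) : E3 :=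
  Submodule.Quotient.mk ⟨indV s, indV_mem s hs⟩

/-- The standard bilinear form on `W8`. -/
def dotW : W8 →ₗ[ZMod 2] W8 →ₗ[ZMod 2] ZMod 2 :=
  LinearMap.mk₂ (ZMod 2) (fun f g => ∑ i, f i * g i)
    (fun f f' g => by simp [add_mul, Finset.sum_add_distrib])
    (fun c f g => by simp [smul_eq_mul, Finset.mul_sum, mul_assoc])
    (fun f g g' => by simp [mul_add, Finset.sum_add_distrib])
    (fun c f g => by simp [smul_eq_mul, Finset.mul_sum, mul_left_comm])

def dotV : V8 →ₗ[ZMod 2] V8 →ₗ[ZMod 2] ZMod 2 :=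
  LinearMap.compl₁₂ dotW V8.subtype V8.subtype

lemma dotV_apply (f g : V8) : dotV f g = ∑ i, f.1 i * g.1 i := rfl

lemma dotV_one_right (f : V8) : dotV f oneV = 0 := by
  have hf : (∑ i, f.1 i) = 0 := mem_V8.mp f.2
  rw [dotV_apply]
  simpa [oneV, oneW] using hf

lemma dotV_one_left (f : V8) : dotV oneV f = 0 := by
  have hf : (∑ i, f.1 i) = 0 := mem_V8.mp f.2
  rw [dotV_apply]
  simpa [oneV, oneW] using hf

lemma dotV_ker_right (f : V8) : U8 ≤ LinearMap.ker (dotV f) := by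
  show Submodule.span (ZMod 2) {oneV} ≤ _
  rw [Submodule.span_singleton_le_iff_mem, LinearMap.mem_ker]
  exact dotV_one_right f

def pairAux : V8 →ₗ[ZMod 2] (E3 →ₗ[ZMod 2] ZMod 2) where
  toFun f := Submodule.liftQ U8 (dotV f) (dotV_ker_right f)
  map_add' f g := by
    apply LinearMap.ext
    intro x
    obtain ⟨y, rfl⟩ := Submodule.Quotient.mk_surjective U8 x
    simp [Submodule.liftQ_apply, map_add]
  map_smul' c f := by
    apply LinearMap.ext
    intro x
    obtain ⟨y, rfl⟩ := Submodule.Quotient.mk_surjective U8 x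
    simp [Submodule.liftQ_apply, map_smul]

lemma pairAux_ker : U8 ≤ LinearMap.ker pairAux := by
  show Submodule.span (ZMod 2) {oneV} ≤ _
  rw [Submodule.span_singleton_le_iff_mem, LinearMap.mem_ker]
  apply LinearMap.ext
  intro x
  obtain ⟨y, rfl⟩ := Submodule.Quotient.mk_surjective U8 x
  show dotV oneV y = 0
  exact dotV_one_left y

/-- The symplectic pairing `⟨I, J⟩ = |I ∩ J| mod 2` on `E₃`. -/
def pairing : E3 →ₗ[ZMod 2] E3 →ₗ[ZMod 2] ZMod 2 :=
  Submodule.liftQ U8 pairAux pairAux_ker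

/-- The linear action of a permutation of the labels on `W8`. -/
def permW (σ : Equiv.Perm (Fin 8)) : W8 →ₗ[ZMod 2] W8 where
  toFun f := fun i => f (σ.symm i)
  map_add' f g := rfl
  map_smul' c f := rfl

lemma permW_mapsTo (σ : Equiv.Perm (Fin 8)) : ∀ x ∈ V8, permW σ x ∈ V8 := by
  intro x hx
  apply mem_V8.mpr
  have hx' : (∑ i, x i) = 0 := mem_V8.mp hx
  have h : (∑ i, permW σ x i) = ∑ i, x (σ.symm i) := rfl
  rw [h, Equiv.sum_comp σ.symm x]
  exact hx'

def permV (σ : Equiv.Perm (Fin 8)) : V8 →ₗ[ZMod 2] V8 :=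
  (permW σ).restrict (permW_mapsTo σ)

lemma permV_one (σ : Equiv.Perm (Fin 8)) : permV σ oneV = oneV := Subtype.ext rfl

lemma permV_comap (σ : Equiv.Perm (Fin 8)) : U8 ≤ U8.comap (permV σ) := by
  show Submodule.span (ZMod 2) {oneV} ≤ _
  rw [Submodule.span_singleton_le_iff_mem, Submodule.mem_comap, permV_one]
  exact Submodule.mem_span_singleton_self oneV

/-- The induced action of a permutation of the labels on `E₃`. -/
def permE3 (σ : Equiv.Perm (Fin 8)) : E3 →ₗ[ZMod 2] E3 :=
  Submodule.mapQ U8 U8 (permV σ) (permV_comap σ)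

/-- `Sp(6,2)`: the group of linear automorphisms of `E₃` preserving the symplectic pairing. -/
def Sp6 : Subgroup (E3 ≃ₗ[ZMod 2] E3) where
  carrier := {g | ∀ x y : E3, pairing (g x) (g y) = pairing x y}
  one_mem' := fun _ _ => rfl
  mul_mem' := by
    intro a b ha hb x y
    show pairing (a (b x)) (a (b y)) = pairing x y
    rw [ha (b x) (b y), hb x y]
  inv_mem' := by
    intro a ha x y
    show pairing (a.symm x) (a.symm y) = pairing x y
    calc pairing (a.symm x) (a.symm y)
        = pairing (a (a.symm x)) (a (a.symm y)) := (ha _ _).symm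
      _ = pairing x y := by rw [a.apply_symm_apply, a.apply_symm_apply]


/-- The image of a subset of `E₃` under a permutation of the labels. -/
def permImg (σ : Equiv.Perm (Fin 8)) (S : Set E3) : Set E3 := (permE3 σ) '' S

/-- `H_tc`: the zero class together with the classes of the 2-element subsets of `Λ`. -/
def Htc : Set E3 :=
  insert 0 {x | ∃ (s : Finset (Fin 8)) (h : s.card = 2),
    x = toE3 s (by rw [h]; exact ⟨1, rfl⟩)}

/-- `H_Q` for a partition of `Λ` into `Q` and its complement: the zero class together with
the classes of the sets `S ∪ T` with `S ⊆ Q`, `T ⊆ Qᶜ` and `|S| - |T| = ±2`. -/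
def Hline (Q : Finset (Fin 8)) : Set E3 :=
  insert 0 {x | ∃ (S T : Finset (Fin 8)) (hS : S ⊆ Q) (hT : T ⊆ Qᶜ)
      (hc : S.card = T.card + 2 ∨ T.card = S.card + 2),
    x = toE3 (S ∪ T) (by
      have hd : Disjoint S T := Disjoint.mono hS hT disjoint_compl_right
      rw [Finset.card_union_of_disjoint hd]
      rcases hc with h | h
      · exact ⟨T.card + 1, by omega⟩
      · exact ⟨S.card + 1, by omega⟩)}

/-- A hyperelliptic subset of `E₃`: an `S₈`-translate of `H_tc` or of `H_{ABCD}`. -/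
def HyperellipticSet (X : Set E3) : Prop :=
  (∃ σ : Equiv.Perm (Fin 8), permImg σ Htc = X) ∨
  (∃ σ : Equiv.Perm (Fin 8), permImg σ (Hline {0, 1, 2, 3}) = X)


/-! ### The quadratic form -/

def qW (f : W8) : ZMod 2 := ∑ i, ∑ j, if i < j then f i * f j else 0

lemma z2 (a : ZMod 2) : a + a = 0 := CharTwo.add_self_eq_zero a

lemma qW_add (f g : W8) (hf : ∑ i, f i = 0) :
    qW (f + g) = qW f + qW g + ∑ i, f i * g i := by
  have h : qW (f + g) + ∑ i, f i * g i = qW f + qW g + (∑ i, f i) * (∑ i, g i) := by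
    simp only [qW, Fin.sum_univ_eight, Pi.add_apply]
    simp (decide := true) only [if_true, if_false]
    ring
  rw [hf, zero_mul, add_zero] at h
  rw [← h, add_assoc, z2, add_zero]

lemma mk_eq_iff (f g : V8) :
    (Submodule.Quotient.mk f : E3) = Submodule.Quotient.mk g ↔ g = f ∨ g = f + oneV := by
  rw [Submodule.Quotient.eq]
  show f - g ∈ Submodule.span (ZMod 2) {oneV} ↔ _
  rw [Submodule.mem_span_singleton]
  have hneg : ∀ x : V8, x + x = 0 := fun x => by
    apply Subtype.ext; funext i; exact z2 _
  constructor
  · rintro ⟨c, hc⟩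
    have hg : g = f + c • oneV := by
      rw [hc]
      have := hneg f
      have := hneg g
      apply Subtype.ext; funext i
      show g.1 i = f.1 i + (f.1 i - g.1 i)
      generalize g.1 i = a; generalize f.1 i = b
      revert a b; decide
    fin_cases c
    · left; rw [hg]; exact (by simp : f + (0 : ZMod 2) • oneV = f)
    · right; rw [hg]; exact (by simp : f + (1 : ZMod 2) • oneV = f + oneV)
  · rintro (h | h)
    · exact ⟨0, by rw [h]; simp⟩
    · refine ⟨1, ?_⟩
      rw [h, one_smul]
      have := hneg oneV
      rw [sub_add_cancel_left]
      exact (neg_eq_of_add_eq_zero_left this).symm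

lemma qW_one (f : V8) : qW (f + oneV : V8).1 = qW f.1 := by
  have h := qW_add f.1 oneW (mem_V8.mp f.2)
  have h1 : qW oneW = 0 := by decide +kernel
  have h2 : ∑ i, f.1 i * oneW i = 0 := dotV_one_right f
  rw [h1, h2, add_zero, add_zero] at h
  exact h

def qE (x : E3) : ZMod 2 := qW (Function.surjInv (Submodule.Quotient.mk_surjective U8) x).1

lemma qE_mk (f : V8) : qE (Submodule.Quotient.mk f) = qW f.1 := by
  have h := Function.surjInv_eq (Submodule.Quotient.mk_surjective U8)
    (Submodule.Quotient.mk f : E3)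
  unfold qE
  rcases (mk_eq_iff _ _).mp h with h | h
  · exact congrArg (fun t : V8 => qW t.1) h.symm
  · exact (qW_one _).symm.trans (congrArg (fun t : V8 => qW t.1) h.symm)

lemma pairing_mk (f g : V8) :
    pairing (Submodule.Quotient.mk f) (Submodule.Quotient.mk g) = ∑ i, f.1 i * g.1 i := rfl

lemma qE_add (x y : E3) : qE (x + y) = qE x + qE y + pairing x y := by
  obtain ⟨f, rfl⟩ := Submodule.Quotient.mk_surjective U8 x
  obtain ⟨g, rfl⟩ := Submodule.Quotient.mk_surjective U8 y
  rw [← Submodule.Quotient.mk_add, qE_mk, qE_mk, qE_mk, pairing_mk]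
  exact qW_add f.1 g.1 (mem_V8.mp f.2)

lemma pairing_comm (x y : E3) : pairing x y = pairing y x := by
  obtain ⟨f, rfl⟩ := Submodule.Quotient.mk_surjective U8 x
  obtain ⟨g, rfl⟩ := Submodule.Quotient.mk_surjective U8 y
  rw [pairing_mk, pairing_mk]
  exact Finset.sum_congr rfl fun i _ => mul_comm _ _

lemma qE_zero : qE 0 = 0 := by
  have h := qE_mk 0
  rw [Submodule.Quotient.mk_zero] at h
  rw [h]; decide +kernel

lemma permE3_mk (σ : Equiv.Perm (Fin 8)) (f : V8) :
    permE3 σ (Submodule.Quotient.mk f) = Submodule.Quotient.mk (permV σ f) := rfl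

lemma pairing_perm (σ : Equiv.Perm (Fin 8)) (x y : E3) :
    pairing (permE3 σ x) (permE3 σ y) = pairing x y := by
  obtain ⟨f, rfl⟩ := Submodule.Quotient.mk_surjective U8 x
  obtain ⟨g, rfl⟩ := Submodule.Quotient.mk_surjective U8 y
  rw [permE3_mk, permE3_mk, pairing_mk, pairing_mk]
  exact Equiv.sum_comp σ.symm (fun i => f.1 i * g.1 i)

lemma permE3_inv (σ : Equiv.Perm (Fin 8)) (x : E3) : permE3 σ (permE3 σ.symm x) = x := by
  obtain ⟨f, rfl⟩ := Submodule.Quotient.mk_surjective U8 x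
  rw [permE3_mk, permE3_mk]
  congr 1
  apply Subtype.ext; funext i
  show f.1 (σ.symm.symm (σ.symm i)) = f.1 i
  simp

lemma permE3_inv' (σ : Equiv.Perm (Fin 8)) (x : E3) : permE3 σ.symm (permE3 σ x) = x := by
  simpa using permE3_inv σ.symm x

lemma indV_surj (f : W8) : ∃ s : Finset (Fin 8), indV s = f := by
  refine ⟨Finset.univ.filter fun i => f i = 1, ?_⟩
  funext i
  simp only [indV, Finset.mem_filter, Finset.mem_univ, true_and]
  generalize f i = a
  revert a; decide

lemma sum_indV (s : Finset (Fin 8)) : (∑ i, indV s i) = (s.card : ZMod 2) := by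
  simp only [indV]
  rw [Finset.sum_ite_mem, Finset.univ_inter, Finset.sum_const, nsmul_eq_mul, mul_one]

lemma toE3_surj (x : E3) : ∃ (s : Finset (Fin 8)) (hs : Even s.card), x = toE3 s hs := by
  obtain ⟨f, rfl⟩ := Submodule.Quotient.mk_surjective U8 x
  obtain ⟨s, hs⟩ := indV_surj f.1
  have h := mem_V8.mp f.2
  rw [← hs, sum_indV] at h
  have he : Even s.card := by
    rw [ZMod.natCast_eq_zero_iff] at h
    exact even_iff_two_dvd.mpr h
  refine ⟨s, he, ?_⟩
  unfold toE3
  congr 1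
  exact Subtype.ext hs.symm

/-- The value of the quadratic form on a class, in terms of the cardinality. -/
lemma qW_indV (s : Finset (Fin 8)) : qW (indV s) = (s.card.choose 2 : ZMod 2) := by
  revert s; decide +kernel

lemma qE_toE3 (s : Finset (Fin 8)) (hs : Even s.card) :
    qE (toE3 s hs) = (s.card.choose 2 : ZMod 2) := by
  unfold toE3; rw [qE_mk]; exact qW_indV s

lemma qE_perm (σ : Equiv.Perm (Fin 8)) (x : E3) : qE (permE3 σ x) = qE x := by
  obtain ⟨s, hs, rfl⟩ := toE3_surj x
  have hc : (s.map σ.toEmbedding).card = s.card := Finset.card_map _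
  have : permE3 σ (toE3 s hs) = toE3 (s.map σ.toEmbedding) (by rw [hc]; exact hs) := by
    unfold toE3
    rw [permE3_mk]
    congr 1
    apply Subtype.ext; funext i
    show indV s (σ.symm i) = indV (s.map σ.toEmbedding) i
    simp only [indV, Finset.mem_map_equiv]
  rw [this, qE_toE3, qE_toE3, hc]

lemma toE3_compl (s : Finset (Fin 8)) (hs : Even s.card) (hs' : Even sᶜ.card) :
    toE3 s hs = toE3 sᶜ hs' := by
  unfold toE3
  rw [mk_eq_iff]
  right
  apply Subtype.ext; funext i
  show indV sᶜ i = indV s i + 1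
  simp only [indV, Finset.mem_compl]
  by_cases h : i ∈ s <;> simp [h]
  decide

/-! ### The sets attached to even forms -/

def SS (u : E3) : Set E3 := {x | x = 0 ∨ qE x + pairing u x = 1}

lemma Htc_eq : Htc = SS 0 := by
  ext x
  simp only [Htc, SS, Set.mem_insert_iff, Set.mem_setOf_eq, map_zero, LinearMap.zero_apply,
    add_zero]
  apply or_congr_right
  constructor
  · rintro ⟨s, h, rfl⟩
    rw [qE_toE3, h]; rfl
  · intro h
    obtain ⟨s, hs, rfl⟩ := toE3_surj x
    rw [qE_toE3] at h
    have h8 : s.card ≤ 8 := by simpa using s.card_le_univ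
    have h26 : s.card = 2 ∨ s.card = 6 := by
      generalize s.card = n at *
      interval_cases n <;> revert h hs <;> decide
    rcases h26 with h2 | h6
    · exact ⟨s, h2, rfl⟩
    · have hc : sᶜ.card = 2 := by rw [Finset.card_compl, h6]; rfl
      exact ⟨sᶜ, hc, toE3_compl _ _ _⟩

def Q0 : Finset (Fin 8) := {0, 1, 2, 3}

def u0 : E3 := toE3 Q0 (by decide)

lemma key_Q (s : Finset (Fin 8)) : Even s.card →
    ((s.card.choose 2 : ZMod 2) + (((Q0 ∩ s).card : ℕ) : ZMod 2) = 1 ↔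
      ((s ∩ Q0).card = (s ∩ Q0ᶜ).card + 2 ∨ (s ∩ Q0ᶜ).card = (s ∩ Q0).card + 2)) := by
  revert s; decide +kernel

lemma pairing_toE3 (s t : Finset (Fin 8)) (hs : Even s.card) (ht : Even t.card) :
    pairing (toE3 s hs) (toE3 t ht) = ((s ∩ t).card : ZMod 2) := by
  unfold toE3
  rw [pairing_mk, ← sum_indV]
  apply Finset.sum_congr rfl
  intro i _
  simp only [indV, Finset.mem_inter]
  by_cases h : i ∈ s <;> by_cases h' : i ∈ t <;> simp [h, h']

lemma Hline_eq : Hline {0, 1, 2, 3} = SS u0 := by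
  change Hline Q0 = SS u0
  ext x
  simp only [Hline, SS, Set.mem_insert_iff, Set.mem_setOf_eq]
  apply or_congr_right
  constructor
  · rintro ⟨S, T, hS, hT, hc, rfl⟩
    rw [u0, pairing_toE3, qE_toE3]
    have hd : Disjoint S T := Disjoint.mono hS hT disjoint_compl_right
    have h1 : (S ∪ T) ∩ Q0 = S := by
      ext i
      have := @hS i
      have := @hT i
      simp only [Finset.mem_compl, Finset.mem_inter, Finset.mem_union] at *
      tauto
    have h2 : (S ∪ T) ∩ Q0ᶜ = T := by
      ext i
      have := @hS i
      have := @hT i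
      simp only [Finset.mem_compl, Finset.mem_inter, Finset.mem_union] at *
      tauto
    rw [key_Q, h1, h2]
    · exact hc
    · rw [Finset.card_union_of_disjoint hd]
      rcases hc with h | h
      · exact ⟨T.card + 1, by omega⟩
      · exact ⟨S.card + 1, by omega⟩
  · intro h
    obtain ⟨s, hs, rfl⟩ := toE3_surj x
    rw [u0, pairing_toE3, qE_toE3, key_Q s hs] at h
    refine ⟨s ∩ Q0, s ∩ Q0ᶜ, Finset.inter_subset_right, Finset.inter_subset_right, h, ?_⟩
    have : s = s ∩ Q0 ∪ s ∩ Q0ᶜ := by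
      rw [← Finset.inter_union_distrib_left, Finset.union_compl, Finset.inter_univ]
    congr 1

lemma permImg_SS (σ : Equiv.Perm (Fin 8)) (u : E3) : permImg σ (SS u) = SS (permE3 σ u) := by
  have key : ∀ y : E3, y ∈ SS u → permE3 σ y ∈ SS (permE3 σ u) := by
    rintro y (hy | hy)
    · left; rw [hy, map_zero]
    · right; rw [qE_perm, pairing_perm]; exact hy
  ext x
  constructor
  · rintro ⟨y, hy, rfl⟩
    exact key y hy
  · rintro hx
    refine ⟨permE3 σ.symm x, ?_, permE3_inv σ x⟩
    rcases hx with hx | hx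
    · left; rw [hx, map_zero]
    · right
      rw [← qE_perm σ, ← pairing_perm σ, permE3_inv]; exact hx

lemma qE_u0 : qE u0 = 0 := by
  rw [u0, qE_toE3]; decide +kernel

lemma toE3_empty (s : Finset (Fin 8)) (hs : Even s.card) (h : s.card = 0) : toE3 s hs = 0 := by
  have : s = ∅ := Finset.card_eq_zero.mp h
  subst this
  unfold toE3
  rw [← Submodule.Quotient.mk_zero]
  congr 1

lemma hyper_SS (u : E3) (hu : qE u = 0) : HyperellipticSet (SS u) := by
  obtain ⟨s, hs, rfl⟩ := toE3_surj u
  rw [qE_toE3] at hu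
  have h8 : s.card ≤ 8 := by simpa using s.card_le_univ
  have h048 : s.card = 0 ∨ s.card = 4 ∨ s.card = 8 := by
    generalize s.card = n at *
    interval_cases n <;> revert hu hs <;> decide
  have hz : toE3 s hs = 0 → HyperellipticSet (SS (toE3 s hs)) := by
    intro h
    left
    refine ⟨1, ?_⟩
    rw [Htc_eq, permImg_SS, h, map_zero]
  rcases h048 with h | h | h
  · exact hz (toE3_empty s hs h)
  · right
    have e : {x // x ∈ Q0} ≃ {x // x ∈ s} := Fintype.equivOfCardEq (by
      rw [Fintype.card_coe, Fintype.card_coe, h]; rfl)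
    refine ⟨e.extendSubtype, ?_⟩
    rw [Hline_eq, permImg_SS]
    congr 1
    unfold u0 toE3
    rw [permE3_mk]
    congr 1
    apply Subtype.ext; funext i
    show indV Q0 (e.extendSubtype.symm i) = indV s i
    obtain ⟨j, rfl⟩ := e.extendSubtype.surjective i
    rw [Equiv.symm_apply_apply]
    simp only [indV]
    by_cases hj : j ∈ Q0
    · rw [if_pos hj, if_pos (e.extendSubtype_mem j hj)]
    · rw [if_neg hj, if_neg (e.extendSubtype_not_mem j hj)]
  · have hc : sᶜ.card = 0 := by rw [Finset.card_compl, h]; rfl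
    have hc' : Even sᶜ.card := by rw [hc]; exact ⟨0, rfl⟩
    apply hz
    rw [toE3_compl s hs hc']
    exact toE3_empty _ _ hc

/-! ### Nondegeneracy -/

def bb (i : Fin 8) : V8 := ⟨Pi.single i 1 + Pi.single 0 1, by
  apply mem_V8.mpr
  simp [Finset.sum_add_distrib, z2]⟩

lemma sum_bb (f : V8) : f = ∑ i, f.1 i • bb i := by
  apply Subtype.ext
  have h : ((∑ i, f.1 i • bb i : V8) : W8)
      = ∑ i, f.1 i • (Pi.single i (1 : ZMod 2) + Pi.single 0 1 : W8) := by
    rw [Submodule.coe_sum]; rfl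
  rw [h]
  simp only [smul_add, Finset.sum_add_distrib]
  rw [← Finset.sum_smul, mem_V8.mp f.2, zero_smul, add_zero]
  funext j
  simp [Finset.sum_apply, Pi.single_apply]

lemma mk_one : (Submodule.Quotient.mk oneV : E3) = 0 := by
  rw [← Submodule.Quotient.mk_zero, eq_comm, mk_eq_iff]
  right; rw [zero_add]

lemma exists_rep (L : E3 →ₗ[ZMod 2] ZMod 2) : ∃ v, ∀ x, L x = pairing v x := by
  have key : ∀ f : V8, L (Submodule.Quotient.mk f)
      = ∑ i, f.1 i * L (Submodule.Quotient.mk (bb i)) := by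
    intro f
    have h : ∀ f : V8, L (Submodule.Quotient.mk f) = (L ∘ₗ U8.mkQ) f := fun _ => rfl
    rw [h]
    conv_lhs => rw [sum_bb f]
    rw [map_sum]
    apply Finset.sum_congr rfl
    intro i _
    rw [map_smul]; rfl
  have hev : (∑ i, L (Submodule.Quotient.mk (bb i))) = 0 := by
    have h := key oneV
    rw [mk_one, map_zero] at h
    rw [h]
    exact Finset.sum_congr rfl fun i _ => (one_mul _).symm
  refine ⟨Submodule.Quotient.mk ⟨fun i => L (Submodule.Quotient.mk (bb i)), mem_V8.mpr hev⟩, ?_⟩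
  intro x
  obtain ⟨f, rfl⟩ := Submodule.Quotient.mk_surjective U8 x
  rw [key, pairing_mk]
  exact Finset.sum_congr rfl fun i _ => mul_comm _ _

/-! ### Counting -/

def eW (w : Fin 6 → ZMod 2) : W8 := ![w 0, w 1, w 2, w 3, w 4, w 5, ∑ i, w i, 0]

lemma eW_mem (w : Fin 6 → ZMod 2) : eW w ∈ V8 := by
  apply mem_V8.mpr
  have : ∑ i, eW w i = (w 0 + w 1 + w 2 + w 3 + w 4 + w 5) + (∑ i, w i) + 0 := by
    rw [Fin.sum_univ_eight]; rfl
  rw [this, Fin.sum_univ_six, z2, add_zero]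

def eE (w : Fin 6 → ZMod 2) : E3 := Submodule.Quotient.mk ⟨eW w, eW_mem w⟩

lemma eE_bij : Function.Bijective eE := by
  constructor
  · intro w w' h
    rcases (mk_eq_iff _ _).mp h with h | h
    · have h' : eW w' = eW w := congrArg Subtype.val h
      funext i
      have h0 := congrFun h' (i.castLE (by norm_num))
      fin_cases i <;> exact h0.symm
    · have h' : eW w' = eW w + oneW := congrArg Subtype.val h
      have h7 : (0 : ZMod 2) = 0 + 1 := congrFun h' 7
      exact absurd h7 (by decide)
  · have main : ∀ f : V8, f.1 7 = 0 → ∃ w, eE w = Submodule.Quotient.mk f := by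
      intro f h7
      refine ⟨fun i => f.1 (i.castLE (by norm_num)), ?_⟩
      unfold eE
      congr 1
      apply Subtype.ext
      have hs := mem_V8.mp f.2
      rw [Fin.sum_univ_eight, h7, add_zero] at hs
      have h6 : f.1 6 = f.1 0 + f.1 1 + f.1 2 + f.1 3 + f.1 4 + f.1 5 :=
        (CharTwo.add_eq_zero.mp hs).symm
      funext i
      fin_cases i
      · rfl
      · rfl
      · rfl
      · rfl
      · rfl
      · rfl
      · refine Eq.trans ?_ h6.symm
        exact Fin.sum_univ_six (fun i : Fin 6 => f.1 (i.castLE (by norm_num)))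
      · exact h7.symm
    intro x
    obtain ⟨f, rfl⟩ := Submodule.Quotient.mk_surjective U8 x
    by_cases h7 : f.1 7 = 0
    · exact main f h7
    · obtain ⟨w, hw⟩ := main (f + oneV) (by
        show f.1 7 + 1 = 0
        generalize f.1 7 = a at *
        revert a; decide)
      refine ⟨w, hw.trans ?_⟩
      rw [eq_comm, mk_eq_iff]
      right; rfl

lemma card_q (c : ZMod 2) :
    Nat.card {x : E3 // qE x = c} = Fintype.card {w : Fin 6 → ZMod 2 // qW (eW w) = c} := by
  rw [← Nat.card_eq_fintype_card]
  symm
  refine Nat.card_congr (Equiv.subtypeEquiv (Equiv.ofBijective eE eE_bij) ?_)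
  intro w
  show _ ↔ qE (eE w) = c
  unfold eE
  rw [qE_mk]

lemma card_ne : Nat.card {x : E3 // qE x = 1} ≠ Nat.card {x : E3 // qE x = 0} := by
  rw [card_q, card_q]
  decide +kernel

lemma e2 (x : E3) : x + x = 0 := by
  obtain ⟨f, rfl⟩ := Submodule.Quotient.mk_surjective U8 x
  rw [← Submodule.Quotient.mk_add, ← Submodule.Quotient.mk_zero]
  congr 1
  apply Subtype.ext; funext i; exact z2 _

lemma card_shift (u : E3) (c : ZMod 2) :
    Nat.card {x : E3 // qE x + pairing u x = c} = Nat.card {x : E3 // qE x = c + qE u} := by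
  refine Nat.card_congr (Equiv.subtypeEquiv (Equiv.addRight u) ?_)
  intro x
  show _ ↔ qE (x + u) = c + qE u
  rw [qE_add, pairing_comm x u]
  generalize qE x = a; generalize qE u = b; generalize pairing u x = d
  revert a b c d; decide

lemma image_SS (g : E3 ≃ₗ[ZMod 2] E3) (hg : g ∈ Sp6) (u : E3) (hu : qE u = 0) :
    ∃ v, qE v = 0 ∧ ⇑g '' SS u = SS v := by
  have hg' : ∀ x y, pairing (g.symm x) (g.symm y) = pairing x y := fun x y => by
    have h := hg (g.symm x) (g.symm y)
    rw [g.apply_symm_apply, g.apply_symm_apply] at h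
    exact h.symm
  let F : E3 →+ ZMod 2 :=
    { toFun := fun x => qE (g.symm x) + pairing u (g.symm x) + qE x
      map_zero' := by simp [qE_zero]
      map_add' := by
        intro x y
        rw [map_add, qE_add, qE_add, map_add, hg']
        generalize pairing x y = a
        have := z2 a
        linear_combination this }
  obtain ⟨v, hv⟩ := exists_rep (F.toZModLinearMap 2)
  have hF : ∀ x, qE x + pairing v x = qE (g.symm x) + pairing u (g.symm x) := by
    intro x
    have h : qE (g.symm x) + pairing u (g.symm x) + qE x = pairing v x := hv x
    rw [← h]
    linear_combination z2 (qE x)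
  refine ⟨v, ?_, ?_⟩
  · have hc : Nat.card {x : E3 // qE x + pairing v x = 1}
        = Nat.card {x : E3 // qE x + pairing u x = 1} :=
      Nat.card_congr (Equiv.subtypeEquiv g.symm.toEquiv (fun x => by
        rw [hF x]; rfl))
    rw [card_shift, card_shift, hu, add_zero] at hc
    by_contra hne
    have h1 : qE v = 1 := by
      clear hc
      generalize qE v = a at *
      revert a; decide
    rw [h1, z2] at hc
    exact card_ne hc.symm
  · ext x
    constructor
    · rintro ⟨y, hy, rfl⟩
      rcases hy with hy | hy
      · left; rw [hy, map_zero]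
      · right; rw [hF, g.symm_apply_apply]; exact hy
    · intro hx
      refine ⟨g.symm x, ?_, g.apply_symm_apply x⟩
      rcases hx with hx | hx
      · left; rw [hx, map_zero]
      · right; rw [← hF]; exact hx

lemma hyper_iff (X : Set E3) (hX : HyperellipticSet X) : ∃ u, qE u = 0 ∧ X = SS u := by
  rcases hX with ⟨σ, rfl⟩ | ⟨σ, rfl⟩
  · exact ⟨0, qE_zero, by rw [Htc_eq, permImg_SS, map_zero]⟩
  · exact ⟨permE3 σ u0, by rw [qE_perm, qE_u0], by rw [Hline_eq, permImg_SS]⟩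

lemma SS_ne (u : E3) (h : SS 0 = SS u) (x : E3) : pairing u x = 0 := by
  by_cases hx : x = 0
  · rw [hx, map_zero]
  have h1 := Set.ext_iff.mp h x
  simp only [SS, Set.mem_setOf_eq, hx, false_or, map_zero, LinearMap.zero_apply, add_zero] at h1
  generalize qE x = a at *
  generalize pairing u x = b at *
  revert a b; decide

/-- Images of hyperelliptic subsets of `E₃` under `Sp(6,2)` are again
hyperelliptic, and up to the action of `S₈` there are exactly two hyperelliptic subsets:
the orbits of `H_tc` and of `H_{ABCD}` are distinct, and every hyperelliptic subset lies in
one of them. -/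
theorem hyperelliptic_subsets :
    (∀ g : E3 ≃ₗ[ZMod 2] E3, g ∈ Sp6 →
      ∀ X : Set E3, HyperellipticSet X → HyperellipticSet (⇑g '' X)) ∧
    (∀ σ τ : Equiv.Perm (Fin 8), permImg σ Htc ≠ permImg τ (Hline {0, 1, 2, 3})) ∧
    (∀ X : Set E3, HyperellipticSet X →
      (∃ σ : Equiv.Perm (Fin 8), permImg σ Htc = X) ∨
      (∃ σ : Equiv.Perm (Fin 8), permImg σ (Hline {0, 1, 2, 3}) = X)) := by
  refine ⟨?_, ?_, fun X hX => hX⟩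
  · intro g hg X hX
    obtain ⟨u, hu, rfl⟩ := hyper_iff X hX
    obtain ⟨v, hv, h⟩ := image_SS g hg u hu
    rw [h]
    exact hyper_SS v hv
  · intro σ τ h
    rw [Htc_eq, Hline_eq, permImg_SS, permImg_SS, map_zero] at h
    have h1 := SS_ne _ h (permE3 τ (toE3 {0, 4} (by decide)))
    rw [pairing_perm, u0, pairing_toE3] at h1
    exact absurd h1 (by decide +kernel)

end
end

section
/- (i) The vectors v_ln^{ABEF} + v_ln^{ABGH} + v_pln^{ABCD} + v_pln^{EFGH} and max(v_pt^{AB} + v_pt^{CD}, v_pln^{ABCDEF} + v_pln^{ABCDGH}) are PGL-equivalent valuation data (the φ_1^{AB|CD‖EF|GH} blocks). (ii) The vectors max(v_ln^{ABC} + v_ln^{FGH}, v_pln^{ABCDE} + v_pln^{DEFGH}), v_pt^{DE} + v_ln^{ABCD} + v_ln^{ABCE}, and v_ln^{ABCD} + v_ln^{ABCE} + v_pln^{ABCFGH} are pairwise PGL-equivalent valuation data (the φ_2^{ABC|FGH} blocks). (iii) The vectors v_ln^{ABCD} + v_pln^{ABCD} + v_pln^{EFGH} and v_pt^{ABCD}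 + v_ln^{ABCD} + v_pln^{ABCD} are PGL-equivalent valuation data (the φ_3^{ABCD} blocks). Moreover, every octad whose Plücker valuation vector is one of these vectors is carried by an element of GL_4(O_K̄) to an octad five of whose points are in standard position. -/
open Finset

noncomputable section

/-- The index set of Plücker coordinates: the 4-element subsets of the 8 labels
`Λ = {A,…,H} = Fin 8`. -/
abbrev PIdx : Type := {Q : Finset (Fin 8) // Q.card = 4}

/-- The point-coincidence vector `v_pt^T`, with `v_pt^T(Q) = max (0, |Q ∩ T| - 1)`. -/
def vpt (T : Finset (Fin 8)) : PIdx → ℚ := fun Q => max (((Q.1 ∩ T).card : ℚ) - 1) 0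

/-- The line-coincidence vector `v_ln^T`, with `v_ln^T(Q) = max (0, |Q ∩ T| - 2)`. -/
def vln (T : Finset (Fin 8)) : PIdx → ℚ := fun Q => max (((Q.1 ∩ T).card : ℚ) - 2) 0

/-- The plane-coincidence vector `v_pln^T`, with `v_pln^T(Q) = max (0, |Q ∩ T| - 3)`. -/
def vpln (T : Finset (Fin 8)) : PIdx → ℚ := fun Q => max (((Q.1 ∩ T).card : ℚ) - 3) 0

/-- An octad: an 8-tuple of points of `P³` given by coordinate vectors in `F⁴`. -/
abbrev Octad (F : Type) : Type := Fin 8 → Fin 4 → F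

variable {F : Type} [Field F]

/-- The chosen affine representatives are normalized: every coordinate has valuation `≥ 0`
and the minimum coordinate valuation of every point is `0`. -/
def Normalized (v : AddValuation F (WithTop ℚ)) (O : Octad F) : Prop :=
  ∀ i, (∀ j, 0 ≤ v (O i j)) ∧ ∃ j, v (O i j) = 0

/-- The 4×4 matrix whose columns are the four points of the octad indexed by `Q`. -/
def subMat (O : Octad F) (Q : PIdx) : Matrix (Fin 4) (Fin 4) F :=
  Matrix.of fun r c => O (Q.1.orderEmbOfFin Q.2 c) r

/-- `O` has Plücker valuation vector `w`, i.e. for every 4-element subset `Q` of the labels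
the valuation of the corresponding Plücker coordinate is `w Q`. -/
def HasPluck (v : AddValuation F (WithTop ℚ)) (O : Octad F) (w : PIdx → ℚ) : Prop :=
  ∀ Q : PIdx, v ((subMat O Q).det) = ((w Q : ℚ) : WithTop ℚ)

/-- `O'` is obtained from `O` by a projective linear transformation of `P³`
(composed with a rescaling of the affine representative of each point). -/
def PGLMove (O O' : Octad F) : Prop :=
  ∃ M : Matrix (Fin 4) (Fin 4) F, IsUnit M.det ∧
    ∃ c : Fin 8 → F, (∀ i, c i ≠ 0) ∧ ∀ i, O' i = c i • M.mulVec (O i)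

/-- PGL-equivalence of valuation data: every octad with Plücker valuation vector `w` is
carried by some element of `PGL₄` to an octad with Plücker valuation vector `w'`, and
vice versa. -/
def PGLequiv (v : AddValuation F (WithTop ℚ)) (w w' : PIdx → ℚ) : Prop :=
  (∀ O : Octad F, Normalized v O → HasPluck v O w →
      ∃ O' : Octad F, Normalized v O' ∧ PGLMove O O' ∧ HasPluck v O' w') ∧
  (∀ O : Octad F, Normalized v O → HasPluck v O w' →
      ∃ O' : Octad F, Normalized v O' ∧ PGLMove O O' ∧ HasPluck v O' w)

/-- A matrix with integral entries (valuations `≥ 0`). -/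
def IntegralMat (v : AddValuation F (WithTop ℚ)) (M : Matrix (Fin 4) (Fin 4) F) : Prop :=
  ∀ i j, 0 ≤ v (M i j)

/-- An element of `GL₄(O)`: an invertible matrix with entries in the valuation ring whose
inverse also has entries in the valuation ring. -/
def GLIntegral (v : AddValuation F (WithTop ℚ)) (M : Matrix (Fin 4) (Fin 4) F) : Prop :=
  IntegralMat v M ∧ ∃ N, IntegralMat v N ∧ M * N = 1 ∧ N * M = 1

/-- The five standard points `(1:0:0:0), (0:1:0:0), (0:0:1:0), (0:0:0:1), (1:1:1:1)`. -/
def stdFive : Fin 5 → Fin 4 → F :=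
  ![![1, 0, 0, 0], ![0, 1, 0, 0], ![0, 0, 1, 0], ![0, 0, 0, 1], ![1, 1, 1, 1]]

/-- Five of the points of the octad are the five standard points of `P³`. -/
def FiveStandard (O : Octad F) : Prop :=
  ∃ ι : Fin 5 → Fin 8, Function.Injective ι ∧
    ∃ lam : Fin 5 → F, (∀ k, lam k ≠ 0) ∧ ∀ k, O (ι k) = lam k • stdFive k

/-- Every octad with Plücker valuation vector `w` is carried by an element of `GL₄(O)` to an
octad five of whose points are the standard points. -/
def GLOStd (v : AddValuation F (WithTop ℚ)) (w : PIdx → ℚ) : Prop :=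
  ∀ O : Octad F, Normalized v O → HasPluck v O w →
    ∃ M : Matrix (Fin 4) (Fin 4) F, GLIntegral v M ∧
      ∃ O' : Octad F, Normalized v O' ∧
        (∃ c : Fin 8 → F, (∀ i, c i ≠ 0) ∧ ∀ i, O' i = c i • M.mulVec (O i)) ∧
        FiveStandard O'

/-- The `φ₁^{AB|CD‖EF|GH}`-block valuation data. -/
def phi1a : PIdx → ℚ := vln {0, 1, 4, 5} + vln {0, 1, 6, 7} + vpln {0, 1, 2, 3} + vpln {4, 5, 6, 7}
def phi1b : PIdx → ℚ := (vpt {0, 1} + vpt {2, 3}) ⊔ (vpln {0, 1, 2, 3, 4, 5} + vpln {0, 1, 2, 3, 6, 7})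

/-- The `φ₂^{ABC|FGH}`-block valuation data. -/
def phi2a : PIdx → ℚ := (vln {0, 1, 2} + vln {5, 6, 7}) ⊔ (vpln {0, 1, 2, 3, 4} + vpln {3, 4, 5, 6, 7})
def phi2b : PIdx → ℚ := vpt {3, 4} + vln {0, 1, 2, 3} + vln {0, 1, 2, 4}
def phi2c : PIdx → ℚ := vln {0, 1, 2, 3} + vln {0, 1, 2, 4} + vpln {0, 1, 2, 5, 6, 7}

/-- The `φ₃^{ABCD}`-block valuation data. -/
def phi3a : PIdx → ℚ := vln {0, 1, 2, 3} + vpln {0, 1, 2, 3} + vpln {4, 5, 6, 7}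
def phi3b : PIdx → ℚ := vpt {0, 1, 2, 3} + vln {0, 1, 2, 3} + vpln {0, 1, 2, 3}

def colMat (O : Octad F) (g : Fin 4 → Fin 8) : Matrix (Fin 4) (Fin 4) F :=
  Matrix.of fun r c => O (g c) r

/-- `w` is given by the natural number valued function `n` on subsets. -/
def NatW (w : PIdx → ℚ) (n : Finset (Fin 8) → ℕ) : Prop := ∀ Q : PIdx, w Q = (n Q.1 : ℚ)

lemma v_colMat (v : AddValuation F (WithTop ℚ)) (O : Octad F) (w : PIdx → ℚ)
    (n : Finset (Fin 8) → ℕ) (hn : NatW w n) (h : HasPluck v O w)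
    (g : Fin 4 → Fin 8) (hg : Function.Injective g) :
    v (colMat O g).det = (((n (univ.image g) : ℕ) : ℚ) : WithTop ℚ) := by
  have hc : (univ.image g).card = 4 := by
    rw [Finset.card_image_of_injective _ hg]; simp
  have hQ := h ⟨univ.image g, hc⟩
  rw [hn] at hQ
  rw [← hQ]
  have hex : ∀ c : Fin 4, ∃ d : Fin 4, (univ.image g).orderEmbOfFin hc d = g c := by
    intro c
    have : g c ∈ Set.range ((univ.image g).orderEmbOfFin hc) := by
      rw [Finset.range_orderEmbOfFin]; simp
    exact this
  choose s hs using hex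
  have hsi : Function.Injective s := by
    intro a b hab
    apply hg
    rw [← hs a, ← hs b, hab]
  let σ : Equiv.Perm (Fin 4) := Equiv.ofBijective s (Finite.injective_iff_bijective.mp hsi)
  have hm : colMat O g = (subMat O ⟨univ.image g, hc⟩).submatrix id σ := by
    ext r c
    simp [colMat, subMat, σ, hs]
  rw [hm, Matrix.det_permute']
  rcases Int.units_eq_one_or (Equiv.Perm.sign σ) with h1 | h1 <;> simp [h1]

lemma colMat_not_inj (O : Octad F) (g : Fin 4 → Fin 8) (hg : ¬ Function.Injective g) :
    (colMat O g).det = 0 := by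
  rw [Function.Injective] at hg
  push Not at hg
  obtain ⟨a, b, hab, hne⟩ := hg
  apply Matrix.det_zero_of_column_eq hne
  intro k
  simp [colMat, hab]

lemma v_colMat_nonneg (v : AddValuation F (WithTop ℚ)) (O : Octad F) (w : PIdx → ℚ)
    (n : Finset (Fin 8) → ℕ) (hn : NatW w n) (h : HasPluck v O w)
    (g : Fin 4 → Fin 8) : 0 ≤ v (colMat O g).det := by
  by_cases hg : Function.Injective g
  · rw [v_colMat v O w n hn h g hg]
    exact_mod_cast Nat.zero_le _
  · rw [colMat_not_inj O g hg]; simp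

/-- Cramer: coordinates in the basis given by the columns `f`. -/
lemma cramer_coord (O : Octad F) (f : Fin 4 → Fin 8) (i : Fin 8) (j : Fin 4)
    (hB : (colMat O f).det ≠ 0) :
    ((colMat O f)⁻¹.mulVec (O i)) j =
      (colMat O f).det⁻¹ * (colMat O (Function.update f j i)).det := by
  have h1 : colMat O (Function.update f j i) = (colMat O f).updateCol j (O i) := by
    ext r c
    by_cases hc : c = j
    · subst hc; simp [colMat]
    · simp [colMat, hc]
  rw [h1, ← Matrix.cramer_apply, Matrix.cramer_eq_adjugate_mulVec, Matrix.inv_def,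
    Matrix.smul_mulVec]
  simp [Ring.inverse_eq_inv']

lemma inv_mulVec_self (O : Octad F) (f : Fin 4 → Fin 8) (j : Fin 4)
    (hB : (colMat O f).det ≠ 0) :
    (colMat O f)⁻¹.mulVec (O (f j)) = Pi.single j 1 := by
  have h1 : O (f j) = (colMat O f).mulVec (Pi.single j 1) := by
    ext r; simp [colMat]
  rw [h1, Matrix.mulVec_mulVec, Matrix.nonsing_inv_mul _ (isUnit_iff_ne_zero.mpr hB),
    Matrix.one_mulVec]

lemma normalized_of_std (v : AddValuation F (WithTop ℚ)) (O : Octad F) (w : PIdx → ℚ)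
    (n : Finset (Fin 8) → ℕ) (hn : NatW w n) (h : HasPluck v O w)
    (f : Fin 4 → Fin 8) (hf : colMat O f = 1)
    (hg : ∀ i, ∃ j, Function.Injective (Function.update f j i) ∧
      n (univ.image (Function.update f j i)) = 0) : Normalized v O := by
  have key : ∀ i j, O i j = (colMat O (Function.update f j i)).det := by
    intro i j
    have := cramer_coord O f i j (by simp [hf])
    simpa [hf] using this
  intro i
  refine ⟨fun j => ?_, ?_⟩
  · rw [key]; exact v_colMat_nonneg v O w n hn h _
  · obtain ⟨j, hj, hz⟩ := hg i
    refine ⟨j, ?_⟩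
    rw [key, v_colMat v O w n hn h _ hj, hz]; simp

lemma v_det_move (v : AddValuation F (WithTop ℚ)) (O O' : Octad F)
    (M : Matrix (Fin 4) (Fin 4) F) (c : Fin 8 → F) (γ : Fin 8 → ℤ)
    (hc : ∀ i, v (c i) = ((γ i : ℚ) : WithTop ℚ))
    (hO : ∀ i, O' i = c i • M.mulVec (O i)) (g : Fin 4 → Fin 8) :
    v (colMat O' g).det = v M.det + v (colMat O g).det
      + (((∑ j, γ (g j) : ℤ) : ℚ) : WithTop ℚ) := by
  have h1 : colMat O' g = M * colMat O g * Matrix.diagonal (c ∘ g) := by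
    ext r k
    rw [Matrix.mul_diagonal]
    simp [colMat, hO, Matrix.mul_apply, Matrix.mulVec, dotProduct, mul_comm]
  rw [h1, Matrix.det_mul, Matrix.det_mul, Matrix.det_diagonal, v.map_mul, v.map_mul]
  congr 1
  simp [Fin.prod_univ_four, Fin.sum_univ_four, hc]

lemma move_lemma (v : AddValuation F (WithTop ℚ))
    (hsurj : ∀ q : ℚ, ∃ x : F, v x = (q : WithTop ℚ))
    (w w' : PIdx → ℚ) (n n' : Finset (Fin 8) → ℕ) (hn : NatW w n) (hn' : NatW w' n')
    (γ : Fin 8 → ℤ) (d : ℤ)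
    (hlin : ∀ Q : Finset (Fin 8), Q.card = 4 → (n' Q : ℤ) = n Q + d + ∑ i ∈ Q, γ i)
    (f : Fin 4 → Fin 8) (hf : Function.Injective f) (hf0 : n' (univ.image f) = 0)
    (hg : ∀ i, ∃ j, Function.Injective (Function.update f j i) ∧
      n' (univ.image (Function.update f j i)) = 0)
    (O : Octad F) (h : HasPluck v O w) :
    ∃ O' : Octad F, Normalized v O' ∧ PGLMove O O' ∧ HasPluck v O' w' := by
  choose c hc using fun i => hsurj (γ i : ℚ)
  have hc0 : ∀ i, c i ≠ 0 := by
    intro i hi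
    have := hc i
    rw [hi, v.map_zero] at this
    exact WithTop.coe_ne_top this.symm
  have hBv := v_colMat v O w n hn h f hf
  have hB : (colMat O f).det ≠ 0 := by
    intro h0
    rw [h0, v.map_zero] at hBv
    exact WithTop.coe_ne_top hBv.symm
  set M : Matrix (Fin 4) (Fin 4) F :=
    Matrix.diagonal (fun j => (c (f j))⁻¹) * (colMat O f)⁻¹ with hM
  have hMdet : M.det ≠ 0 := by
    rw [hM, Matrix.det_mul, Matrix.det_diagonal, Matrix.det_nonsing_inv,
      Ring.inverse_eq_inv']
    exact mul_ne_zero (Finset.prod_ne_zero_iff.mpr fun j _ => inv_ne_zero (hc0 _))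
      (inv_ne_zero hB)
  set O' : Octad F := fun i => c i • M.mulVec (O i) with hO'
  have hstd : colMat O' f = 1 := by
    ext r k
    have e : O' (f k) = Pi.single k 1 := by
      simp only [hO', hM]
      rw [← Matrix.mulVec_mulVec, inv_mulVec_self O f k hB]
      ext r
      by_cases hr : r = k
      · subst hr
        simp [hc0]
      · simp [hr, Matrix.diagonal]
    simp only [colMat, Matrix.of_apply, e, Matrix.one_apply, Pi.single_apply]
  have hmv := v_det_move v O O' M c γ hc (fun i => rfl)
  obtain ⟨m, hm⟩ : ∃ m : ℚ, v M.det = (m : WithTop ℚ) := by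
    have : v M.det ≠ ⊤ := by rwa [Ne, v.top_iff]
    exact ⟨_, (WithTop.coe_untop _ this).symm⟩
  have hsum : ∀ g : Fin 4 → Fin 8, Function.Injective g →
      ((n' (univ.image g) : ℕ) : ℤ) = n (univ.image g) + d + ∑ j, γ (g j) := by
    intro g hg
    rw [hlin _ (by rw [Finset.card_image_of_injective _ hg]; simp),
      Finset.sum_image (fun a _ b _ hab => hg hab)]
  have hmd : m = d := by
    have h1 := hmv f
    rw [hstd, Matrix.det_one, v.map_one, hm, hBv] at h1
    have h2 : (0 : ℚ) = m + ((n (univ.image f) : ℕ) : ℚ) + ((∑ j, γ (f j) : ℤ) : ℚ) := by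
      exact_mod_cast h1
    have h3 := hsum f hf
    rw [hf0] at h3
    have h4 : (0 : ℚ) = ((n (univ.image f) : ℕ) : ℚ) + d + ((∑ j, γ (f j) : ℤ) : ℚ) := by
      exact_mod_cast h3
    linarith
  have hP : HasPluck v O' w' := by
    intro Q
    have hi : Function.Injective (Q.1.orderEmbOfFin Q.2) := (Q.1.orderEmbOfFin Q.2).injective
    have him : univ.image (Q.1.orderEmbOfFin Q.2) = Q.1 := by
      apply Finset.coe_injective
      simp
    have h1 := hmv (Q.1.orderEmbOfFin Q.2)
    rw [v_colMat v O w n hn h _ hi, hm, hmd] at h1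
    have h2 := hsum _ hi
    rw [him] at h1 h2
    rw [hn' Q]
    change v (colMat O' (Q.1.orderEmbOfFin Q.2)).det = _
    rw [h1]
    have h4 : ((n' Q.1 : ℕ) : ℚ) = ((n Q.1 : ℕ) : ℚ) + d
        + ((∑ j, γ (Q.1.orderEmbOfFin Q.2 j) : ℤ) : ℚ) := by
      exact_mod_cast h2
    rw [h4, ← WithTop.coe_add, ← WithTop.coe_add]
    congr 1
    ring
  exact ⟨O', normalized_of_std v O' w' n' hn' hP f hstd hg,
    ⟨M, isUnit_iff_ne_zero.mpr hMdet, c, hc0, fun i => rfl⟩, hP⟩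

lemma pgl_lemma (v : AddValuation F (WithTop ℚ))
    (hsurj : ∀ q : ℚ, ∃ x : F, v x = (q : WithTop ℚ))
    (w w' : PIdx → ℚ) (n n' : Finset (Fin 8) → ℕ) (hn : NatW w n) (hn' : NatW w' n')
    (γ : Fin 8 → ℤ) (d : ℤ)
    (hlin : ∀ Q : Finset (Fin 8), Q.card = 4 → (n' Q : ℤ) = n Q + d + ∑ i ∈ Q, γ i)
    (f : Fin 4 → Fin 8)
    (hf : Function.Injective f ∧ n (univ.image f) = 0 ∧
      ∀ i, ∃ j, Function.Injective (Function.update f j i) ∧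
        n (univ.image (Function.update f j i)) = 0)
    (f' : Fin 4 → Fin 8)
    (hf' : Function.Injective f' ∧ n' (univ.image f') = 0 ∧
      ∀ i, ∃ j, Function.Injective (Function.update f' j i) ∧
        n' (univ.image (Function.update f' j i)) = 0) : PGLequiv v w w' := by
  refine ⟨fun O _ h => move_lemma v hsurj w w' n n' hn hn' γ d hlin f' hf'.1 hf'.2.1 hf'.2.2 O h,
    fun O _ h => move_lemma v hsurj w' w n' n hn' hn (-γ) (-d) ?_ f hf.1 hf.2.1 hf.2.2 O h⟩
  intro Q hQ
  rw [hlin Q hQ]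
  simp
  ring

lemma v_sum_nonneg (v : AddValuation F (WithTop ℚ)) (a b : Fin 4 → F)
    (ha : ∀ j, 0 ≤ v (a j)) (hb : ∀ j, 0 ≤ v (b j)) : 0 ≤ v (∑ j, a j * b j) := by
  apply v.map_le_sum
  intro j _
  rw [v.map_mul]
  exact add_nonneg (ha j) (hb j)

lemma integral_mul (v : AddValuation F (WithTop ℚ)) (A B : Matrix (Fin 4) (Fin 4) F)
    (hA : IntegralMat v A) (hB : IntegralMat v B) : IntegralMat v (A * B) := by
  intro i j
  rw [Matrix.mul_apply]
  exact v_sum_nonneg v (fun k => A i k) (fun k => B k j) (hA i) (fun k => hB k j)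

lemma integral_diagonal (v : AddValuation F (WithTop ℚ)) (p : Fin 4 → F)
    (hp : ∀ j, 0 ≤ v (p j)) : IntegralMat v (Matrix.diagonal p) := by
  intro i j
  rw [Matrix.diagonal_apply]
  split_ifs
  · exact hp i
  · simp

lemma integral_det (v : AddValuation F (WithTop ℚ)) (A : Matrix (Fin 4) (Fin 4) F)
    (hA : IntegralMat v A) : 0 ≤ v A.det := by
  rw [Matrix.det_succ_row_zero]
  apply v.map_le_sum
  intro j _
  simp only [Matrix.det_fin_three, Matrix.submatrix_apply]
  have hs : ∀ a b c : F, 0 ≤ v a → 0 ≤ v b → 0 ≤ v c → 0 ≤ v (a * b * c) := by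
    intro a b c ha hb hc
    rw [v.map_mul, v.map_mul]
    exact add_nonneg (add_nonneg ha hb) hc
  have hadd : ∀ a b : F, 0 ≤ v a → 0 ≤ v b → 0 ≤ v (a + b) :=
    fun a b ha hb => v.map_le_add ha hb
  have hsub : ∀ a b : F, 0 ≤ v a → 0 ≤ v b → 0 ≤ v (a - b) :=
    fun a b ha hb => v.map_le_sub ha hb
  apply hs
  · rw [v.map_pow]; simp
  · exact hA _ _
  · repeat' first
      | apply hsub
      | apply hadd
      | apply hs
      | apply hA

lemma integralMat_inv (v : AddValuation F (WithTop ℚ)) (A : Matrix (Fin 4) (Fin 4) F)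
    (hA : IntegralMat v A) (hd : v A.det = 0) : IntegralMat v A⁻¹ := by
  intro i j
  rw [Matrix.inv_def, Ring.inverse_eq_inv', Matrix.smul_apply, smul_eq_mul, v.map_mul, v.map_inv, hd,
    Matrix.adjugate_apply]
  have : 0 ≤ v (A.updateRow j (Pi.single i 1)).det := by
    apply integral_det
    intro a b
    rw [Matrix.updateRow_apply]
    split_ifs
    · rw [Pi.single_apply]
      split_ifs <;> simp
    · exact hA a b
  simpa using this

lemma glo_lemma (v : AddValuation F (WithTop ℚ))
    (w : PIdx → ℚ) (n : Finset (Fin 8) → ℕ) (hn : NatW w n)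
    (f : Fin 4 → Fin 8) (e : Fin 8)
    (hf : Function.Injective f ∧ n (univ.image f) = 0 ∧
      (∀ j, f j ≠ e) ∧
      ∀ j, Function.Injective (Function.update f j e) ∧
        n (univ.image (Function.update f j e)) = 0) : GLOStd v w := by
  intro O hN h
  obtain ⟨hfi, hf0, hfe, hfu⟩ := hf
  have hBv : v (colMat O f).det = 0 := by
    rw [v_colMat v O w n hn h f hfi, hf0]; simp
  have hB : (colMat O f).det ≠ 0 := by
    intro h0
    rw [h0, v.map_zero] at hBv
    exact absurd hBv (by simp)
  have hBI : IntegralMat v (colMat O f) := fun r c => (hN (f c)).1 r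
  set p : Fin 4 → F := (colMat O f)⁻¹.mulVec (O e) with hp
  have hpv : ∀ j, v (p j) = 0 := by
    intro j
    rw [hp, cramer_coord O f e j hB, v.map_mul, v.map_inv, hBv,
      v_colMat v O w n hn h _ (hfu j).1, (hfu j).2]
    simp
  have hp0 : ∀ j, p j ≠ 0 := by
    intro j h0
    have := hpv j
    rw [h0, v.map_zero] at this
    exact absurd this (by simp)
  have hu : IsUnit (colMat O f).det := isUnit_iff_ne_zero.mpr hB
  set M : Matrix (Fin 4) (Fin 4) F := Matrix.diagonal (fun j => (p j)⁻¹) * (colMat O f)⁻¹ with hM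
  set N : Matrix (Fin 4) (Fin 4) F := colMat O f * Matrix.diagonal p with hNdef
  have hMI : IntegralMat v M := integral_mul v _ _
    (integral_diagonal v _ (fun j => by rw [v.map_inv, hpv]; simp)) (integralMat_inv v _ hBI hBv)
  have hNI : IntegralMat v N := integral_mul v _ _ hBI
    (integral_diagonal v _ (fun j => (hpv j).ge))
  have hNM : N * M = 1 := by
    rw [hM, hNdef, Matrix.mul_assoc, ← Matrix.mul_assoc (Matrix.diagonal p),
      Matrix.diagonal_mul_diagonal]
    have : (fun i => p i * (p i)⁻¹) = fun _ => (1 : F) := by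
      ext i; exact mul_inv_cancel₀ (hp0 i)
    rw [this, Matrix.diagonal_one, Matrix.one_mul, Matrix.mul_nonsing_inv _ hu]
  have hMN : M * N = 1 := mul_eq_one_comm.mp hNM
  refine ⟨M, ⟨hMI, N, hNI, hMN, hNM⟩, fun i => M.mulVec (O i), ?_,
    ⟨fun _ => 1, fun _ => one_ne_zero, fun i => (one_smul _ _).symm⟩, ?_⟩
  · intro i
    have h0 : ∀ j, 0 ≤ v (M.mulVec (O i) j) := fun j =>
      v_sum_nonneg v (M j) (O i) (hMI j) (hN i).1
    refine ⟨h0, ?_⟩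
    by_contra hcon
    push Not at hcon
    obtain ⟨k, hk⟩ := (hN i).2
    have hOi : O i = N.mulVec (M.mulVec (O i)) := by
      rw [Matrix.mulVec_mulVec, hNM, Matrix.one_mulVec]
    rw [hOi] at hk
    have : 0 < v (N.mulVec (M.mulVec (O i)) k) := by
      rw [Matrix.mulVec, dotProduct]
      apply v.map_lt_sum WithTop.zero_ne_top
      intro j _
      rw [v.map_mul]
      exact lt_of_lt_of_le (lt_of_le_of_ne (h0 j) (hcon j).symm) (le_add_of_nonneg_left (hNI k j))
    exact this.ne' hk
  · refine ⟨Fin.snoc f e, ?_, Fin.snoc (fun j => (p j)⁻¹) 1, ?_, ?_⟩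
    · rw [Fin.snoc_injective_iff]
      exact ⟨hfi, by rintro ⟨j, hj⟩; exact hfe j hj⟩
    · intro k
      refine Fin.lastCases ?_ (fun j => ?_) k
      · rw [Fin.snoc_last]; exact one_ne_zero
      · rw [Fin.snoc_castSucc]; exact inv_ne_zero (hp0 j)
    · intro k
      refine Fin.lastCases ?_ (fun j => ?_) k
      · simp only [Fin.snoc_last, one_smul]
        rw [hM, ← Matrix.mulVec_mulVec, ← hp]
        ext r
        rw [Matrix.mulVec_diagonal, inv_mul_cancel₀ (hp0 r)]
        fin_cases r <;> rfl
      · simp only [Fin.snoc_castSucc]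
        rw [hM, ← Matrix.mulVec_mulVec, inv_mulVec_self O f j hB]
        ext r
        rw [Matrix.mulVec_diagonal]
        fin_cases j <;> fin_cases r <;> simp [stdFive]

lemma max_sub_cast (a k : ℕ) : max ((a : ℚ) - k) 0 = ((a - k : ℕ) : ℚ) := by
  rcases le_total k a with h | h
  · rw [Nat.cast_sub h, max_eq_left]
    have : (k : ℚ) ≤ a := by exact_mod_cast h
    linarith
  · rw [Nat.sub_eq_zero_of_le h, max_eq_right]
    · simp
    · have : (a : ℚ) ≤ k := by exact_mod_cast h
      linarith

/-- The natural-number version of the three coincidence vectors. -/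
def ncoin (k : ℕ) (T : Finset (Fin 8)) : Finset (Fin 8) → ℕ := fun Q => (Q ∩ T).card - k

lemma natW_pt (T : Finset (Fin 8)) : NatW (vpt T) (ncoin 1 T) := fun Q => by
  simpa [vpt, ncoin] using max_sub_cast (Q.1 ∩ T).card 1
lemma natW_ln (T : Finset (Fin 8)) : NatW (vln T) (ncoin 2 T) := fun Q => by
  simpa [vln, ncoin] using max_sub_cast (Q.1 ∩ T).card 2
lemma natW_pln (T : Finset (Fin 8)) : NatW (vpln T) (ncoin 3 T) := fun Q => by
  simpa [vpln, ncoin] using max_sub_cast (Q.1 ∩ T).card 3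
lemma NatW.add {w w' : PIdx → ℚ} {n n' : Finset (Fin 8) → ℕ} (h : NatW w n) (h' : NatW w' n') :
    NatW (w + w') (fun Q => n Q + n' Q) := fun Q => by
  simp [h Q, h' Q]
lemma NatW.sup {w w' : PIdx → ℚ} {n n' : Finset (Fin 8) → ℕ} (h : NatW w n) (h' : NatW w' n') :
    NatW (w ⊔ w') (fun Q => max (n Q) (n' Q)) := fun Q => by
  simp [h Q, h' Q]

def n1a : Finset (Fin 8) → ℕ := fun Q => ncoin 2 {0, 1, 4, 5} Q + ncoin 2 {0, 1, 6, 7} Q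
  + ncoin 3 {0, 1, 2, 3} Q + ncoin 3 {4, 5, 6, 7} Q
def n1b : Finset (Fin 8) → ℕ := fun Q => max (ncoin 1 {0, 1} Q + ncoin 1 {2, 3} Q)
  (ncoin 3 {0, 1, 2, 3, 4, 5} Q + ncoin 3 {0, 1, 2, 3, 6, 7} Q)
def n2a : Finset (Fin 8) → ℕ := fun Q => max (ncoin 2 {0, 1, 2} Q + ncoin 2 {5, 6, 7} Q)
  (ncoin 3 {0, 1, 2, 3, 4} Q + ncoin 3 {3, 4, 5, 6, 7} Q)
def n2b : Finset (Fin 8) → ℕ := fun Q => ncoin 1 {3, 4} Q + ncoin 2 {0, 1, 2, 3} Q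
  + ncoin 2 {0, 1, 2, 4} Q
def n2c : Finset (Fin 8) → ℕ := fun Q => ncoin 2 {0, 1, 2, 3} Q + ncoin 2 {0, 1, 2, 4} Q
  + ncoin 3 {0, 1, 2, 5, 6, 7} Q
def n3a : Finset (Fin 8) → ℕ := fun Q => ncoin 2 {0, 1, 2, 3} Q + ncoin 3 {0, 1, 2, 3} Q
  + ncoin 3 {4, 5, 6, 7} Q
def n3b : Finset (Fin 8) → ℕ := fun Q => ncoin 1 {0, 1, 2, 3} Q + ncoin 2 {0, 1, 2, 3} Q
  + ncoin 3 {0, 1, 2, 3} Q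

lemma h1a : NatW phi1a n1a :=
  (((natW_ln _).add (natW_ln _)).add (natW_pln _)).add (natW_pln _)
lemma h1b : NatW phi1b n1b :=
  ((natW_pt _).add (natW_pt _)).sup ((natW_pln _).add (natW_pln _))
lemma h2a : NatW phi2a n2a :=
  ((natW_ln _).add (natW_ln _)).sup ((natW_pln _).add (natW_pln _))
lemma h2b : NatW phi2b n2b := ((natW_pt _).add (natW_ln _)).add (natW_ln _)
lemma h2c : NatW phi2c n2c := ((natW_ln _).add (natW_ln _)).add (natW_pln _)
lemma h3a : NatW phi3a n3a := ((natW_ln _).add (natW_pln _)).add (natW_pln _)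
lemma h3b : NatW phi3b n3b := ((natW_pt _).add (natW_ln _)).add (natW_pln _)

/-- (i) The two `φ₁^{AB|CD‖EF|GH}`-block valuation data are PGL-equivalent;
(ii) the three `φ₂^{ABC|FGH}`-block valuation data are pairwise PGL-equivalent; (iii) the two
`φ₃^{ABCD}`-block valuation data are PGL-equivalent.  Moreover, every octad with one of these
Plücker valuation vectors is carried by an element of `GL₄(O)` to an octad five of whose
points are in standard position.  (Labels: `A,…,H = 0,…,7`.) -/
theorem phi_blocks_PGL_equivalent
    (F : Type) [Field F] [IsAlgClosed F] (v : AddValuation F (WithTop ℚ))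
    (hsurj : ∀ q : ℚ, ∃ x : F, v x = (q : WithTop ℚ))
    (hres : v 2 = 0) :
    PGLequiv v phi1a phi1b ∧
    PGLequiv v phi2a phi2b ∧ PGLequiv v phi2b phi2c ∧ PGLequiv v phi2a phi2c ∧
    PGLequiv v phi3a phi3b ∧
    GLOStd v phi1a ∧ GLOStd v phi1b ∧
    GLOStd v phi2a ∧ GLOStd v phi2b ∧ GLOStd v phi2c ∧
    GLOStd v phi3a ∧ GLOStd v phi3b := by
  refine ⟨?_, ?_, ?_, ?_, ?_, ?_, ?_, ?_, ?_, ?_, ?_, ?_⟩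
  · exact pgl_lemma v hsurj _ _ _ _ h1a h1b ![0, 0, 1, 1, 0, 0, 0, 0] (-1)
      (by decide +kernel) ![0, 2, 3, 4] (by decide +kernel) ![0, 2, 4, 6] (by decide +kernel)
  · exact pgl_lemma v hsurj _ _ _ _ h2a h2b ![0, 0, 0, 0, 0, -1, -1, -1] (2)
      (by decide +kernel) ![0, 1, 3, 5] (by decide +kernel) ![0, 1, 5, 6] (by decide +kernel)
  · exact pgl_lemma v hsurj _ _ _ _ h2b h2c ![0, 0, 0, -1, -1, 0, 0, 0] (1)
      (by decide +kernel) ![0, 1, 5, 6] (by decide +kernel) ![0, 3, 4, 5] (by decide +kernel)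
  · exact pgl_lemma v hsurj _ _ _ _ h2a h2c ![0, 0, 0, -1, -1, -1, -1, -1] (3)
      (by decide +kernel) ![0, 1, 3, 5] (by decide +kernel) ![0, 3, 4, 5] (by decide +kernel)
  · exact pgl_lemma v hsurj _ _ _ _ h3a h3b ![0, 0, 0, 0, -1, -1, -1, -1] (3)
      (by decide +kernel) ![0, 1, 4, 5] (by decide +kernel) ![0, 4, 5, 6] (by decide +kernel)
  · exact glo_lemma v _ _ h1a ![0, 2, 3, 4] 6 (by decide +kernel)
  · exact glo_lemma v _ _ h1b ![0, 4, 5, 6] 7 (by decide +kernel)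
  · exact glo_lemma v _ _ h2a ![0, 1, 3, 5] 6 (by decide +kernel)
  · exact glo_lemma v _ _ h2b ![0, 1, 5, 6] 7 (by decide +kernel)
  · exact glo_lemma v _ _ h2c ![0, 3, 4, 5] 6 (by decide +kernel)
  · exact glo_lemma v _ _ h3a ![0, 1, 4, 5] 6 (by decide +kernel)
  · exact glo_lemma v _ _ h3b ![0, 4, 5, 6] 7 (by decide +kernel)

end
end
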